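/- arXiv:2306.12125 — 2 statements merged into one kernel-verified Lean document; each statement's English description precedes it below -/
import Mathlib

section
/- Let M ≥ 1, dimensions p_1, …, p_M ≥ 1, I = ∏_{m=1}^M {1,…,p_m}, and ν > 2. On a probability space, let Z = (Z(j))_{j∈I} be a family of i.i.d. standard normal random variables (the law of Z is the product over I of N(0,1)) and let G be an independent random variable with the Gamma distribution with shape ν/2 and rate ν/2. For each m let Σ_m ∈ ℝ^{p_m×p_m} be symmetric positive definite with Σ_m = L_m L_mᵀ. Let μ : I → ℝ, define the tensor normal array X(i) = Σ_{j∈I} (∏_{m=1}^M L_m(i_m, j_m)) Z(j), and set Y = μ + G^{-1/2} X, so that Y ~ TT(μ, {Σ_1,…,Σ_M}, ν). Fix a mode m and let J = ∏_{j≠m}{1,…,p_j}; for a ∈ {1,…,p_m} and i ∈ J let Y_(m)(a, i) denote Y evaluated at the multi-index with m-th coordinate a and remaining coordinates i (mode-m matricization), and similarly μ_(m). Let C be any real J×J matrix, and let K_{−m} be the J×J matrix with entries K_{−m}(i, i') = ∏_{j≠m} Σ_j(i_j, i'_j). Then for all a, b ∈ {1,…,p_m}, the expectation E[(Y_(m)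 C Y_(m)ᵀ)(a,b)] exists and equals (ν/(ν−2)) · tr(C K_{−m}) · Σ_m(a,b) + (μ_(m) C μ_(m)ᵀ)(a,b). In particular, if μ = 0 then E[Y_(m) Y_(m)ᵀ] = (ν/(ν−2)) (∏_{j≠m} tr(Σ_j)) Σ_m. -/
open MeasureTheory ProbabilityTheory Matrix Real Filter

/-- Multi-indices of an `M`-way tensor with mode dimensions `p`. -/
abbrev MultiIndex (M : ℕ) (p : Fin M → ℕ) : Type := (m : Fin M) → Fin (p m)

/-- Multi-indices over all modes other than `m0`. -/
abbrev OffIndex (M : ℕ) (p : Fin M → ℕ) (m0 : Fin M) : Type :=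
  (j : {j : Fin M // j ≠ m0}) → Fin (p j.1)

/-- The full multi-index whose `m0`-th coordinate is `a` and whose remaining
coordinates are given by `i` (used to express the mode-`m0` matricization). -/
def embIdx {M : ℕ} {p : Fin M → ℕ} (m0 : Fin M) (a : Fin (p m0))
    (i : OffIndex M p m0) : MultiIndex M p :=
  fun j => if h : j = m0 then cast (congrArg (fun k => Fin (p k)) h.symm) a else i ⟨j, h⟩

lemma measurable_gammaPDF (a r : ℝ) : Measurable (gammaPDF a r) :=
  (measurable_gammaPDFReal a r).ennreal_ofReal

lemma integral_rpow_gammaMeasure {a r s : ℝ} (ha : 0 < a) (hr : 0 < r) (has : 0 < a + s) :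
    ∫ x, x ^ s ∂(gammaMeasure a r) = (1 / r) ^ s * (Gamma (a + s) / Gamma a) := by
  rw [gammaMeasure, integral_withDensity_eq_integral_toReal_smul
    (measurable_gammaPDF a r) (ae_of_all _ fun _ ↦ ENNReal.ofReal_lt_top)]
  have h : (fun x ↦ (gammaPDF a r x).toReal • x ^ s) =ᵐ[volume]
      (Set.Ioi 0).indicator
        fun x ↦ r ^ a / Gamma a * (x ^ (a + s - 1) * exp (-(r * x))) := by
    filter_upwards [Measure.ae_ne volume 0] with x hx
    rw [gammaPDF, ENNReal.toReal_ofReal (gammaPDFReal_nonneg ha hr x), gammaPDFReal, smul_eq_mul]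
    rcases hx.lt_or_gt with hx | hx
    · simp [hx.not_ge, hx.not_gt]
    · rw [if_pos hx.le, Set.indicator_of_mem (Set.mem_Ioi.2 hx),
        show a + s - 1 = (a - 1) + s by ring, rpow_add hx]
      ring
  rw [integral_congr_ae h, integral_indicator measurableSet_Ioi, integral_const_mul,
    integral_rpow_mul_exp_neg_mul_Ioi has hr, rpow_add (by positivity), one_div,
    inv_rpow hr.le a]
  have := (rpow_pos_of_pos hr a).ne'
  field_simp

lemma integrable_rpow_gammaMeasure {a r s : ℝ} (ha : 0 < a) (hr : 0 < r) (has : 0 < a + s) :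
    Integrable (fun x ↦ x ^ s) (gammaMeasure a r) := by
  refine Integrable.of_integral_ne_zero ?_
  rw [integral_rpow_gammaMeasure ha hr has]
  have := Gamma_pos_of_pos ha
  have := Gamma_pos_of_pos has
  positivity

lemma ae_gammaMeasure_nonneg (a r : ℝ) : ∀ᵐ x ∂(gammaMeasure a r), 0 ≤ x := by
  rw [gammaMeasure, ae_withDensity_iff (measurable_gammaPDF a r)]
  refine ae_of_all _ fun x hx ↦ ?_
  by_contra! h
  exact hx (gammaPDF_of_neg h)

lemma integral_inv_gammaMeasure {ν : ℝ} (hν : 2 < ν) :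
    ∫ x, x ^ (-1 : ℝ) ∂(gammaMeasure (ν / 2) (ν / 2)) = ν / (ν - 2) := by
  have h : ν / 2 + -1 ≠ 0 := by linarith
  have hG := Gamma_add_one h
  rw [show ν / 2 + -1 + 1 = ν / 2 by ring] at hG
  have h1 := Gamma_pos_of_pos (show 0 < ν / 2 + -1 by linarith)
  rw [integral_rpow_gammaMeasure (by linarith) (by linarith) (by linarith), hG, rpow_neg_one]
  have h2 : ν - 2 ≠ 0 := by linarith
  have h3 : ν / 2 + -1 = (ν - 2) / 2 := by ring
  rw [h3] at h1 ⊢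
  field_simp

section GammaScale

variable {Ω : Type*} [MeasurableSpace Ω] {P : Measure Ω} {G : Ω → ℝ} {ν : ℝ}

lemma sq_rpow_neg_half {x : ℝ} (hx : 0 ≤ x) : (x ^ (-(1 / 2) : ℝ)) ^ 2 = x ^ (-1 : ℝ) := by
  rw [← rpow_natCast, ← rpow_mul hx]
  norm_num

lemma memLp_rpow_neg_half (hν : 2 < ν) (hG : Measurable G)
    (hlaw : P.map G = gammaMeasure (ν / 2) (ν / 2)) :
    MemLp (fun ω ↦ G ω ^ (-(1 / 2) : ℝ)) 2 P := by
  have hmp : MeasurePreserving G P (gammaMeasure (ν / 2) (ν / 2)) := ⟨hG, hlaw⟩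
  refine MemLp.comp_measurePreserving (g := fun x : ℝ ↦ x ^ (-(1 / 2) : ℝ)) ?_ hmp
  rw [memLp_two_iff_integrable_sq (by fun_prop)]
  refine (integrable_rpow_gammaMeasure (s := -1) (by linarith) (by linarith)
    (by linarith)).congr ?_
  filter_upwards [ae_gammaMeasure_nonneg (ν / 2) (ν / 2)] with x hx using (sq_rpow_neg_half hx).symm

lemma integral_sq_rpow_neg_half (hν : 2 < ν) (hG : Measurable G)
    (hlaw : P.map G = gammaMeasure (ν / 2) (ν / 2)) :
    ∫ ω, (G ω ^ (-(1 / 2) : ℝ)) ^ 2 ∂P = ν / (ν - 2) := by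
  rw [← integral_inv_gammaMeasure hν, ← integral_map (f := fun x : ℝ ↦ (x ^ (-(1 / 2) : ℝ)) ^ 2)
    hG.aemeasurable (by fun_prop), hlaw]
  refine integral_congr_ae ?_
  filter_upwards [ae_gammaMeasure_nonneg (ν / 2) (ν / 2)] with x hx using sq_rpow_neg_half hx

end GammaScale

section StandardNormal

variable {Ω ι : Type*} [MeasurableSpace Ω] {P : Measure Ω} [Fintype ι] {Z : Ω → ι → ℝ}

lemma measurePreserving_coord (hZ : Measurable Z)
    (hlaw : P.map Z = Measure.pi fun _ ↦ gaussianReal 0 1) (j : ι) :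
    MeasurePreserving (fun ω ↦ Z ω j) P (gaussianReal 0 1) :=
  (measurePreserving_eval (fun _ : ι ↦ gaussianReal 0 1) j).comp ⟨hZ, hlaw⟩

lemma memLp_coord (hZ : Measurable Z)
    (hlaw : P.map Z = Measure.pi fun _ ↦ gaussianReal 0 1) (j : ι) :
    MemLp (fun ω ↦ Z ω j) 2 P :=
  (memLp_id_gaussianReal' 2 (by simp)).comp_measurePreserving (measurePreserving_coord hZ hlaw j)

lemma integral_coord (hZ : Measurable Z)
    (hlaw : P.map Z = Measure.pi fun _ ↦ gaussianReal 0 1) (j : ι) :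
    ∫ ω, Z ω j ∂P = 0 := by
  have h := measurePreserving_coord hZ hlaw j
  rw [← integral_map (f := fun x : ℝ ↦ x) h.aemeasurable (by fun_prop), h.map_eq,
    integral_id_gaussianReal]

lemma integral_coord_mul_coord [IsProbabilityMeasure P] [DecidableEq ι] (hZ : Measurable Z)
    (hlaw : P.map Z = Measure.pi fun _ ↦ gaussianReal 0 1) (j k : ι) :
    ∫ ω, Z ω j * Z ω k ∂P = if j = k then 1 else 0 := by
  have hm (j : ι) : Measurable fun ω ↦ Z ω j := (measurePreserving_coord hZ hlaw j).measurable
  split_ifs with hjk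
  · subst hjk
    have h := measurePreserving_coord hZ hlaw j
    have hv := variance_fun_id_gaussianReal (μ := 0) (v := 1)
    rw [variance_of_integral_eq_zero (by fun_prop) integral_id_gaussianReal] at hv
    rw [← integral_map (f := fun x : ℝ ↦ x * x) h.aemeasurable (by fun_prop), h.map_eq]
    simpa [sq] using hv
  · have hi : iIndepFun (fun j ω ↦ Z ω j) P := by
      rw [iIndepFun_iff_map_fun_eq_pi_map fun j ↦ (hm j).aemeasurable]
      simp_rw [fun j ↦ (measurePreserving_coord hZ hlaw j).map_eq]
      exact hlaw
    rw [(hi.indepFun hjk).integral_fun_mul_eq_mul_integral (hm j).aestronglyMeasurable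
      (hm k).aestronglyMeasurable, integral_coord hZ hlaw, zero_mul]

lemma memLp_linearCombination (hZ : Measurable Z)
    (hlaw : P.map Z = Measure.pi fun _ ↦ gaussianReal 0 1) (u : ι → ℝ) :
    MemLp (fun ω ↦ ∑ j, u j * Z ω j) 2 P :=
  memLp_finsetSum _ fun j _ ↦ (memLp_coord hZ hlaw j).const_mul (u j)

lemma integral_linearCombination [IsProbabilityMeasure P] (hZ : Measurable Z)
    (hlaw : P.map Z = Measure.pi fun _ ↦ gaussianReal 0 1) (u : ι → ℝ) :
    ∫ ω, ∑ j, u j * Z ω j ∂P = 0 := by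
  rw [integral_finsetSum _ fun j _ ↦
    ((memLp_coord hZ hlaw j).integrable (by norm_num)).const_mul (u j)]
  simp [integral_const_mul, integral_coord hZ hlaw]

lemma integral_linearCombination_mul [IsProbabilityMeasure P] (hZ : Measurable Z)
    (hlaw : P.map Z = Measure.pi fun _ ↦ gaussianReal 0 1) (u v : ι → ℝ) :
    ∫ ω, (∑ j, u j * Z ω j) * ∑ k, v k * Z ω k ∂P = ∑ j, u j * v j := by
  classical
  have hterm (j k : ι) : Integrable (fun ω ↦ u j * v k * (Z ω j * Z ω k)) P :=
    ((memLp_coord hZ hlaw j).integrable_mul (memLp_coord hZ hlaw k)).const_mul _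
  have hmul (ω : Ω) (j k : ι) : u j * Z ω j * (v k * Z ω k) = u j * v k * (Z ω j * Z ω k) :=
    mul_mul_mul_comm _ _ _ _
  simp_rw [Finset.sum_mul_sum, hmul]
  rw [integral_finsetSum _ fun j _ ↦ integrable_finsetSum _ fun k _ ↦ hterm j k]
  refine Finset.sum_congr rfl fun j _ ↦ ?_
  rw [integral_finsetSum _ fun k _ ↦ hterm j k]
  simp [integral_const_mul, integral_coord_mul_coord hZ hlaw]

end StandardNormal

/-- The second moments of a random scale mixture `c + W X`, where the scale `W` is independent of
the pair of centred variables `X`, `X'` taken together. -/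
lemma integral_scaleMixture_mul {Ω : Type*} [MeasurableSpace Ω] {P : Measure Ω}
    [IsProbabilityMeasure P] {W X X' : Ω → ℝ} (hW : MemLp W 2 P) (hX : MemLp X 2 P)
    (hX' : MemLp X' 2 P) (hindep : IndepFun (fun ω ↦ (X ω, X' ω)) W P)
    (hX0 : ∫ ω, X ω ∂P = 0) (hV0 : ∫ ω, X' ω ∂P = 0) (c c' : ℝ) :
    Integrable (fun ω ↦ (c + W ω * X ω) * (c' + W ω * X' ω)) P ∧
      ∫ ω, (c + W ω * X ω) * (c' + W ω * X' ω) ∂P =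
        (∫ ω, W ω ^ 2 ∂P) * (∫ ω, X ω * X' ω ∂P) + c * c' := by
  have e : (fun ω ↦ (c + W ω * X ω) * (c' + W ω * X' ω)) =
      fun ω ↦ W ω ^ 2 * (X ω * X' ω) + (c * (W ω * X' ω) + c' * (W ω * X ω) + c * c') := by
    ext ω
    ring
  have i1 : IndepFun W X P := (hindep.comp measurable_fst measurable_id).symm
  have i2 : IndepFun W X' P := (hindep.comp measurable_snd measurable_id).symm
  have i3 : IndepFun (fun ω ↦ W ω ^ 2) (fun ω ↦ X ω * X' ω) P :=
    (hindep.comp (φ := fun x : ℝ × ℝ ↦ x.1 * x.2) (ψ := fun x : ℝ ↦ x ^ 2)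
      (by fun_prop) (by fun_prop)).symm
  have hXX : Integrable (fun ω ↦ X ω * X' ω) P := hX.integrable_mul hX'
  have h1 : Integrable (fun ω ↦ c' * (W ω * X ω)) P := (hW.integrable_mul hX).const_mul c'
  have h2 : Integrable (fun ω ↦ c * (W ω * X' ω)) P := (hW.integrable_mul hX').const_mul c
  have h3 : Integrable (fun ω ↦ W ω ^ 2 * (X ω * X' ω)) P := i3.integrable_mul hW.integrable_sq hXX
  have h12 : Integrable (fun ω ↦ c * (W ω * X' ω) + c' * (W ω * X ω)) P := h2.add h1
  have h4 : Integrable (fun ω ↦ c * (W ω * X' ω) + c' * (W ω * X ω) + c * c') P :=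
    h12.add (integrable_const (c * c'))
  rw [e]
  refine ⟨h3.add h4, ?_⟩
  rw [integral_add h3 h4, integral_add h12 (integrable_const _), integral_add h2 h1,
    integral_const_mul, integral_const_mul,
    i3.integral_fun_mul_eq_mul_integral hW.integrable_sq.1 hXX.1,
    i1.integral_fun_mul_eq_mul_integral hW.1 hX.1, i2.integral_fun_mul_eq_mul_integral hW.1 hX'.1,
    hX0, hV0]
  simp

lemma sum_prod_mul_prod_eq_prod {M : ℕ} {p : Fin M → ℕ}
    (L : (m : Fin M) → Matrix (Fin (p m)) (Fin (p m)) ℝ) (i k : MultiIndex M p) :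
    ∑ j : MultiIndex M p, (∏ m, L m (i m) (j m)) * ∏ m, L m (k m) (j m) =
      ∏ m, (L m * (L m)ᵀ) (i m) (k m) := by
  simp_rw [← Finset.prod_mul_distrib, Matrix.mul_apply, Matrix.transpose_apply,
    Finset.prod_univ_sum, Fintype.piFinset_univ]

lemma prod_embIdx {M : ℕ} {p : Fin M → ℕ} (m0 : Fin M)
    (S : (m : Fin M) → Matrix (Fin (p m)) (Fin (p m)) ℝ) (a b : Fin (p m0))
    (i k : OffIndex M p m0) :
    ∏ m, S m (embIdx m0 a i m) (embIdx m0 b k m) =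
      S m0 a b * ∏ j : {j : Fin M // j ≠ m0}, S j.1 (i j) (k j) := by
  rw [← Fintype.prod_subtype_mul_prod_subtype (fun m ↦ m ≠ m0), mul_comm]
  congr 1
  · refine (Fintype.prod_eq_single (⟨m0, not_not.2 rfl⟩ : {m // ¬m ≠ m0})
      fun x hx ↦ (hx (Subtype.ext (not_not.1 x.2))).elim).trans ?_
    simp [embIdx]
  · refine Finset.prod_congr rfl fun j _ ↦ ?_
    simp [embIdx, j.2]

/-- Proposition 1(b): for `Y ~ TT(μ, {Σ_1,…,Σ_M}, ν)` with `ν > 2` and any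
matrix `C`, `E[(Y_(m) C Y_(m)ᵀ)(a,b)] = (ν/(ν−2)) tr(C K_{−m}) Σ_m(a,b) + (μ_(m) C μ_(m)ᵀ)(a,b)`. -/
theorem stmt1 {Ω : Type*} [MeasureSpace Ω] [IsProbabilityMeasure (ℙ : Measure Ω)]
    (M : ℕ) (hM : 1 ≤ M) (p : Fin M → ℕ) (hp : ∀ m, 1 ≤ p m) (ν : ℝ) (hν : 2 < ν)
    (Z : Ω → MultiIndex M p → ℝ) (G : Ω → ℝ)
    (hZmeas : Measurable Z) (hGmeas : Measurable G)
    (hZlaw : Measure.map Z ℙ = Measure.pi fun _ : MultiIndex M p => gaussianReal 0 1)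
    (hGlaw : Measure.map G ℙ = gammaMeasure (ν / 2) (ν / 2))
    (hindep : IndepFun Z G ℙ)
    (Sig L : (m : Fin M) → Matrix (Fin (p m)) (Fin (p m)) ℝ)
    (hSpos : ∀ m, (Sig m).PosDef) (hfact : ∀ m, Sig m = L m * (L m)ᵀ)
    (μ : MultiIndex M p → ℝ)
    (X : Ω → MultiIndex M p → ℝ)
    (hX : ∀ ω i, X ω i = ∑ j : MultiIndex M p, (∏ m, L m (i m) (j m)) * Z ω j)
    (Y : Ω → MultiIndex M p → ℝ)
    (hY : ∀ ω i, Y ω i = μ i + (G ω) ^ (-(1 / 2) : ℝ) * X ω i)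
    (m0 : Fin M)
    (C : Matrix (OffIndex M p m0) (OffIndex M p m0) ℝ) :
    ∀ a b : Fin (p m0),
      Integrable
        (fun ω => ∑ i : OffIndex M p m0, ∑ i' : OffIndex M p m0,
          Y ω (embIdx m0 a i) * C i i' * Y ω (embIdx m0 b i')) ℙ ∧
      ∫ ω, (∑ i : OffIndex M p m0, ∑ i' : OffIndex M p m0,
          Y ω (embIdx m0 a i) * C i i' * Y ω (embIdx m0 b i')) ∂ℙ =
        ν / (ν - 2) *
            Matrix.trace (C * Matrix.of fun i i' : OffIndex M p m0 =>
              ∏ j : {j : Fin M // j ≠ m0}, Sig j.1 (i j) (i' j)) *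
            Sig m0 a b +
          ∑ i : OffIndex M p m0, ∑ i' : OffIndex M p m0,
            μ (embIdx m0 a i) * C i i' * μ (embIdx m0 b i') := by
  intro a b
  have hW := memLp_rpow_neg_half hν hGmeas hGlaw
  have hXL : ∀ i, (fun ω ↦ X ω i) = fun ω ↦ ∑ j, (∏ m, L m (i m) (j m)) * Z ω j :=
    fun i ↦ funext fun ω ↦ hX ω i
  have hX2 (i) : MemLp (fun ω ↦ X ω i) 2 ℙ := by
    rw [hXL]
    exact memLp_linearCombination hZmeas hZlaw _
  have hX0 (i) : ∫ ω, X ω i ∂ℙ = 0 := by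
    rw [hXL]
    exact integral_linearCombination hZmeas hZlaw _
  have hcov (i k) : ∫ ω, X ω i * X ω k ∂ℙ = ∏ m, Sig m (i m) (k m) := by
    simp_rw [hX, integral_linearCombination_mul hZmeas hZlaw, hfact]
    exact sum_prod_mul_prod_eq_prod L i k
  have hXG (i k) : IndepFun (fun ω ↦ (X ω i, X ω k)) (fun ω ↦ G ω ^ (-(1 / 2) : ℝ)) ℙ := by
    simp_rw [hX]
    exact hindep.comp (φ := fun z : MultiIndex M p → ℝ ↦
      (∑ j, (∏ m, L m (i m) (j m)) * z j, ∑ j, (∏ m, L m (k m) (j m)) * z j))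
      (ψ := fun x : ℝ ↦ x ^ (-(1 / 2) : ℝ)) (by fun_prop) (by fun_prop)
  have hYY (i k) := integral_scaleMixture_mul hW (hX2 i) (hX2 k) (hXG i k) (hX0 i) (hX0 k)
    (μ i) (μ k)
  simp_rw [← hY, hcov, integral_sq_rpow_neg_half hν hGmeas hGlaw] at hYY
  simp_rw [mul_right_comm _ (C _ _)]
  have hterm (i i') : Integrable
      (fun ω ↦ Y ω (embIdx m0 a i) * Y ω (embIdx m0 b i') * C i i') ℙ :=
    (hYY _ _).1.mul_const _
  have hintsum (i) := integrable_finsetSum Finset.univ fun i' _ ↦ hterm i i'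
  refine ⟨integrable_finsetSum _ fun i _ ↦ hintsum i, ?_⟩
  rw [integral_finsetSum _ fun i _ ↦ hintsum i]
  simp_rw [integral_finsetSum _ fun i' _ ↦ hterm _ i', integral_mul_const, (hYY _ _).2,
    prod_embIdx, add_mul, Finset.sum_add_distrib]
  congr 1
  simp_rw [Matrix.trace, Matrix.diag_apply, Matrix.mul_apply, Matrix.of_apply, Finset.mul_sum,
    Finset.sum_mul]
  refine Finset.sum_congr rfl fun i _ ↦ Finset.sum_congr rfl fun i' _ ↦ ?_
  have hsymm : ∏ j : {j : Fin M // j ≠ m0}, Sig j.1 (i j) (i' j) =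
      ∏ j : {j : Fin M // j ≠ m0}, Sig j.1 (i' j) (i j) :=
    Finset.prod_congr rfl fun j _ ↦ by simpa using (hSpos j.1).isHermitian.apply (i' j) (i j)
  rw [hsymm]
  ring
end

section
/- Let p ≥ 1, ν > 0, and let Σ ∈ ℝ^{p×p} be symmetric positive definite. Let f(y) = Γ((ν+p)/2)·((πν)^{p/2}Γ(ν/2)(det Σ)^{1/2})^{-1}·(1 + yᵀΣ^{-1}y/ν)^{-(ν+p)/2} be the centered multivariate t density on ℝ^p, and let w(y) = (ν+p)/(ν + yᵀΣ^{-1}y). Then the matrix-valued integrals below converge entrywise and: (i) ∫_{ℝ^p} w(y)·y yᵀ·f(y) dy = Σ; and (ii) ∫_{ℝ^p} w(y)²·y yᵀ·f(y) dy = ((ν+p)/(ν+p+2))·Σ. (These weighted second-moment identities for the multivariate t-distribution are the key moment computations behind the Fisher information J = ((ν+p)/(ν+p+2))·Σ_X ⊗ Σ^{-1} in Theorem 1, part 4, and the asymptotic covariance of the one-step estimator in Theorem 5.) -/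
open MeasureTheory Matrix Real

/-- The centered multivariate t density with scatter `S` and degrees of freedom `ν`. -/
noncomputable def centeredTDensity (p : ℕ) (ν : ℝ)
    (S : Matrix (Fin p) (Fin p) ℝ) (y : Fin p → ℝ) : ℝ :=
  Real.Gamma ((ν + p) / 2) /
      ((Real.pi * ν) ^ ((p : ℝ) / 2) * Real.Gamma (ν / 2) * Real.sqrt S.det) *
    (1 + y ⬝ᵥ (S⁻¹).mulVec y / ν) ^ (-(ν + p) / 2)

/-- The reweighting factor `w(y) = (ν+p)/(ν + yᵀΣ^{-1}y)`. -/
noncomputable def tWeight (p : ℕ) (ν : ℝ)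
    (S : Matrix (Fin p) (Fin p) ℝ) (y : Fin p → ℝ) : ℝ :=
  (ν + p) / (ν + y ⬝ᵥ (S⁻¹).mulVec y)

theorem integrable_pow_mul_exp_neg_mul_sq {c : ℝ} (hc : 0 < c) (n : ℕ) :
    Integrable fun x : ℝ => x ^ n * rexp (-c * x ^ 2) := by
  simpa using integrable_rpow_mul_exp_neg_mul_sq hc
    (show (-1 : ℝ) < n by have : (0 : ℝ) ≤ n := n.cast_nonneg; linarith)

theorem integral_mul_exp_neg_mul_sq (c : ℝ) : ∫ x : ℝ, x * rexp (-c * x ^ 2) = 0 := by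
  have h := integral_neg_eq_self (fun x : ℝ => x * rexp (-c * x ^ 2)) volume
  simp only [neg_sq, neg_mul, integral_neg] at h ⊢
  linarith

theorem integral_sq_mul_exp_neg_mul_sq {c : ℝ} (hc : 0 < c) :
    ∫ x : ℝ, x ^ 2 * rexp (-c * x ^ 2) = √(π / c) * (1 / (2 * c)) := by
  have h := integral_comp_abs (f := fun x : ℝ => x ^ 2 * rexp (-c * x ^ 2))
  simp only [sq_abs] at h
  rw [h]
  have h2 := integral_rpow_mul_exp_neg_mul_rpow (p := 2) (q := 2) two_pos (by norm_num) hc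
  simp only [Real.rpow_two] at h2
  rw [h2, show ((2 : ℝ) + 1) / 2 = 1 / 2 + 1 by norm_num, Real.Gamma_add_one (by norm_num),
    Real.Gamma_one_half_eq, Real.sqrt_div Real.pi_pos.le,
    show -((2 : ℝ) + 1) / 2 = -(1 / 2) + -1 by norm_num, Real.rpow_add hc, Real.rpow_neg hc.le,
    Real.rpow_neg_one, ← Real.sqrt_eq_rpow]
  field_simp

section GaussianMoments

variable {ι : Type*} [Fintype ι] [DecidableEq ι]

theorem mul_mul_exp_neg_mul_dotProduct_self (c : ℝ) (i j : ι) (x : ι → ℝ) :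
    x i * x j * rexp (-c * (x ⬝ᵥ x)) =
      ∏ k, (x k ^ ((if k = i then 1 else 0) + (if k = j then 1 else 0)) *
        rexp (-c * x k ^ 2)) := by
  simp only [Finset.prod_mul_distrib, pow_add, pow_ite, pow_one, pow_zero, Finset.prod_ite_eq',
    Finset.mem_univ, if_true, ← Real.exp_sum, ← Finset.mul_sum, dotProduct, sq]

theorem integrable_mul_mul_exp_neg_mul_dotProduct_self {c : ℝ} (hc : 0 < c) (i j : ι) :
    Integrable fun x : ι → ℝ => x i * x j * rexp (-c * (x ⬝ᵥ x)) := by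
  simp only [mul_mul_exp_neg_mul_dotProduct_self]
  exact Integrable.fintype_prod (f := fun k (t : ℝ) =>
    t ^ ((if k = i then 1 else 0) + (if k = j then 1 else 0)) * rexp (-c * t ^ 2))
    fun k => integrable_pow_mul_exp_neg_mul_sq hc _

theorem integral_mul_mul_exp_neg_mul_dotProduct_self {c : ℝ} (hc : 0 < c) (i j : ι) :
    ∫ x : ι → ℝ, x i * x j * rexp (-c * (x ⬝ᵥ x)) =
      if i = j then √(π / c) ^ Fintype.card ι * (1 / (2 * c)) else 0 := by
  simp only [mul_mul_exp_neg_mul_dotProduct_self]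
  rw [integral_fintype_prod_volume_eq_prod (fun k (t : ℝ) =>
    t ^ ((if k = i then 1 else 0) + (if k = j then 1 else 0)) * rexp (-c * t ^ 2))]
  split_ifs with h
  · subst h
    have hk (k : ι) : ∫ t : ℝ, t ^ ((if k = i then 1 else 0) + (if k = i then 1 else 0)) *
        rexp (-c * t ^ 2) = √(π / c) * if k = i then 1 / (2 * c) else 1 := by
      split_ifs
      · exact integral_sq_mul_exp_neg_mul_sq hc
      · simpa using integral_gaussian c
    simp only [hk, Finset.prod_mul_distrib, Finset.prod_ite_eq', Finset.mem_univ, if_true,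
      Finset.prod_const, Finset.card_univ]
  · refine Finset.prod_eq_zero (Finset.mem_univ i) ?_
    simpa [h] using integral_mul_exp_neg_mul_sq c

end GaussianMoments

section StudentKernel

variable {ι : Type*} [Fintype ι]

/-- The joint density of a Gaussian scale mixture, weighted by a product of two coordinates. -/
noncomputable def scaleMixture (ν β : ℝ) (i j : ι) (z : (ι → ℝ) × ℝ) : ℝ :=
  z.1 i * z.1 j * (z.2 ^ (β - 1) * rexp (-((1 + z.1 ⬝ᵥ z.1 / ν) * z.2)))

theorem measurable_scaleMixture (ν β : ℝ) (i j : ι) : Measurable (scaleMixture ν β i j) := by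
  unfold scaleMixture dotProduct
  fun_prop

theorem scaleMixture_eq (ν β : ℝ) (i j : ι) (x : ι → ℝ) (t : ℝ) :
    scaleMixture ν β i j (x, t) =
      t ^ (β - 1) * rexp (-t) * (x i * x j * rexp (-(t / ν) * (x ⬝ᵥ x))) := by
  have h : rexp (-((1 + x ⬝ᵥ x / ν) * t)) = rexp (-t) * rexp (-(t / ν) * (x ⬝ᵥ x)) := by
    rw [← Real.exp_add]
    congr 1
    ring
  simp only [scaleMixture, h]
  ring

theorem integral_scaleMixture_right {ν β : ℝ} (hν : 0 < ν) (hβ : 0 < β) (i j : ι) (x : ι → ℝ) :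
    ∫ t in Set.Ioi 0, scaleMixture ν β i j (x, t) =
      Real.Gamma β * (x i * x j * (1 + x ⬝ᵥ x / ν) ^ (-β)) := by
  have hx : 0 ≤ x ⬝ᵥ x := by simpa using dotProduct_star_self_nonneg x
  have hr : 0 < 1 + x ⬝ᵥ x / ν := by positivity
  simp only [scaleMixture, integral_const_mul]
  rw [Real.integral_rpow_mul_exp_neg_mul_Ioi hβ hr, one_div, Real.inv_rpow hr.le,
    Real.rpow_neg hr.le]
  ring

variable [DecidableEq ι]

/-- The common diagonal entry of `∫ x xᵀ (1 + |x|² / ν) ^ (-β) dx`, up to the factor `Γ(β)`. -/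
noncomputable def mixtureMoment (ι : Type*) [Fintype ι] (ν β : ℝ) : ℝ :=
  (π * ν) ^ ((Fintype.card ι : ℝ) / 2) * (ν / 2) *
    Real.Gamma (β - (Fintype.card ι : ℝ) / 2 - 1)

theorem integral_scaleMixture_left {ν t : ℝ} (β : ℝ) (hν : 0 < ν) (ht : 0 < t) (i j : ι) :
    ∫ x, scaleMixture ν β i j (x, t) =
      (if i = j then (π * ν) ^ ((Fintype.card ι : ℝ) / 2) * (ν / 2) else 0) *
        (rexp (-t) * t ^ (β - (Fintype.card ι : ℝ) / 2 - 1 - 1)) := by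
  simp only [scaleMixture_eq, integral_const_mul]
  rw [integral_mul_mul_exp_neg_mul_dotProduct_self (div_pos ht hν)]
  split_ifs with h
  · have hs : √(π / (t / ν)) ^ Fintype.card ι =
        (π * ν) ^ ((Fintype.card ι : ℝ) / 2) / t ^ ((Fintype.card ι : ℝ) / 2) := by
      rw [← Real.div_rpow (by positivity) ht.le, Real.sqrt_eq_rpow, ← Real.rpow_natCast,
        ← Real.rpow_mul (by positivity)]
      congr 1
      · field_simp
      · ring
    rw [hs, show β - (Fintype.card ι : ℝ) / 2 - 1 - 1 = β - 1 - (Fintype.card ι : ℝ) / 2 - 1 by ring,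
      Real.rpow_sub_one ht.ne' (β - 1 - _), Real.rpow_sub ht (β - 1)]
    field_simp
  · simp

theorem integrable_scaleMixture {ν β : ℝ} (hν : 0 < ν)
    (hβ : 0 < β - (Fintype.card ι : ℝ) / 2 - 1) (i j : ι) :
    Integrable (scaleMixture ν β i j)
      ((volume : Measure (ι → ℝ)).prod (volume.restrict (Set.Ioi 0))) := by
  have hdiag (i : ι) : Integrable (scaleMixture ν β i i)
      ((volume : Measure (ι → ℝ)).prod (volume.restrict (Set.Ioi 0))) := by
    refine (integrable_prod_iff' (measurable_scaleMixture ν β i i).aestronglyMeasurable).2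
      ⟨?_, ?_⟩
    · filter_upwards [ae_restrict_mem measurableSet_Ioi] with t ht
      simp only [scaleMixture_eq]
      exact (integrable_mul_mul_exp_neg_mul_dotProduct_self (div_pos ht hν) i i).const_mul _
    · refine ((Real.GammaIntegral_convergent hβ).const_mul
        ((π * ν) ^ ((Fintype.card ι : ℝ) / 2) * (ν / 2))).congr ?_
      filter_upwards [ae_restrict_mem measurableSet_Ioi] with t ht
      have hn (x : ι → ℝ) : ‖scaleMixture ν β i i (x, t)‖ = scaleMixture ν β i i (x, t) := by
        refine Real.norm_of_nonneg ?_
        have := Real.rpow_nonneg (le_of_lt ht) (β - 1)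
        have := mul_self_nonneg (x i)
        simp only [scaleMixture]
        positivity
      simp only [hn, integral_scaleMixture_left β hν ht, if_true]
  refine ((hdiag i).add (hdiag j)).mono' (measurable_scaleMixture ν β i j).aestronglyMeasurable ?_
  have hpos : ∀ᵐ z ∂((volume : Measure (ι → ℝ)).prod (volume.restrict (Set.Ioi (0 : ℝ)))),
      0 < z.2 := Measure.quasiMeasurePreserving_snd.ae (ae_restrict_mem measurableSet_Ioi)
  filter_upwards [hpos] with z hz
  simp only [scaleMixture, Pi.add_apply, ← add_mul, norm_mul, Real.norm_eq_abs, Real.abs_exp,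
    abs_of_nonneg (Real.rpow_nonneg hz.le (β - 1))]
  gcongr
  nlinarith [sq_nonneg (|z.1 i| - |z.1 j|), abs_mul_abs_self (z.1 i), abs_mul_abs_self (z.1 j),
    mul_self_nonneg (z.1 i), mul_self_nonneg (z.1 j)]

theorem integrable_mul_mul_one_add_rpow {ν β : ℝ} (hν : 0 < ν)
    (hβ : 0 < β - (Fintype.card ι : ℝ) / 2 - 1) (i j : ι) :
    Integrable fun x : ι → ℝ => x i * x j * (1 + x ⬝ᵥ x / ν) ^ (-β) := by
  have hβ0 : 0 < β := by
    have : (0 : ℝ) ≤ Fintype.card ι := Nat.cast_nonneg _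
    linarith
  have h := (integrable_scaleMixture hν hβ i j).integral_prod_left
  simp only [integral_scaleMixture_right hν hβ0] at h
  exact (integrable_const_mul_iff (Real.Gamma_pos_of_pos hβ0).ne'.isUnit _).1 h

theorem integral_mul_mul_one_add_rpow {ν β : ℝ} (hν : 0 < ν)
    (hβ : 0 < β - (Fintype.card ι : ℝ) / 2 - 1) (i j : ι) :
    ∫ x : ι → ℝ, x i * x j * (1 + x ⬝ᵥ x / ν) ^ (-β) =
      if i = j then mixtureMoment ι ν β / Real.Gamma β else 0 := by
  have hβ0 : 0 < β := by
    have : (0 : ℝ) ≤ Fintype.card ι := Nat.cast_nonneg _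
    linarith
  have h := integral_integral_swap (f := fun x t => scaleMixture ν β i j (x, t))
    (integrable_scaleMixture hν hβ i j)
  simp only [integral_scaleMixture_right hν hβ0, integral_const_mul] at h
  rw [setIntegral_congr_fun measurableSet_Ioi
    (fun t ht => integral_scaleMixture_left β hν ht i j), integral_const_mul,
    ← Real.Gamma_eq_integral hβ] at h
  rw [← mul_right_inj' (Real.Gamma_pos_of_pos hβ0).ne', h]
  split_ifs
  · rw [mixtureMoment, mul_div_cancel₀ _ (Real.Gamma_pos_of_pos hβ0).ne']
  · simp

end StudentKernel

section LinearChange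

variable {ι : Type*} [Fintype ι]

theorem mulVec_mul_mulVec_mul (A : Matrix ι ι ℝ) (a b : ι) (x : ι → ℝ) (r : ℝ) :
    (A *ᵥ x) a * (A *ᵥ x) b * r = ∑ i, ∑ j, A a i * A b j * (x i * x j * r) := by
  simp only [mulVec, dotProduct]
  rw [Finset.sum_mul_sum, Finset.sum_mul]
  simp only [Finset.sum_mul]
  refine Finset.sum_congr rfl fun i _ => Finset.sum_congr rfl fun j _ => ?_
  ring

variable [DecidableEq ι]

open scoped MatrixOrder in
theorem Matrix.PosDef.exists_eq_mul_transpose {S : Matrix ι ι ℝ} (hS : S.PosDef) :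
    ∃ A : Matrix ι ι ℝ, S = A * Aᵀ ∧ A.det ≠ 0 := by
  obtain ⟨B, hB⟩ := CStarAlgebra.nonneg_iff_eq_star_mul_self.1
    hS.posSemidef.nonneg
  have hB' : S = Bᵀ * Bᵀᵀ := by simpa [star_eq_conjTranspose] using hB
  refine ⟨Bᵀ, hB', fun h => hS.det_pos.ne' ?_⟩
  rw [hB', det_mul, h, zero_mul]

theorem measurableEmbedding_mulVec {A : Matrix ι ι ℝ} (hA : A.det ≠ 0) :
    MeasurableEmbedding A.mulVec :=
  (Continuous.matrix_mulVec continuous_const continuous_id).measurableEmbedding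
    (mulVec_injective_of_isUnit ((isUnit_iff_isUnit_det A).2 hA.isUnit))

theorem integrable_comp_mulVec_iff {A : Matrix ι ι ℝ} (hA : A.det ≠ 0) {f : (ι → ℝ) → ℝ} :
    Integrable (fun x => f (A *ᵥ x)) ↔ Integrable f := by
  have h := Real.map_matrix_volume_pi_eq_smul_volume_pi hA
  have h2 := (measurableEmbedding_mulVec hA).integrable_map_iff (μ := volume) (g := f)
  rw [show A.mulVec = toLin' A from rfl, h, integrable_smul_measure (by simpa using hA)
    ENNReal.ofReal_ne_top] at h2
  exact h2.symm

theorem integral_eq_abs_det_mul_integral_comp_mulVec {A : Matrix ι ι ℝ} (hA : A.det ≠ 0)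
    (f : (ι → ℝ) → ℝ) : ∫ y, f y = |A.det| * ∫ x, f (A *ᵥ x) := by
  have h := Real.map_matrix_volume_pi_eq_smul_volume_pi hA
  have h2 := (measurableEmbedding_mulVec hA).integral_map (μ := volume) f
  rw [show A.mulVec = toLin' A from rfl, h, integral_smul_measure,
    ENNReal.toReal_ofReal (abs_nonneg _), abs_inv, smul_eq_mul] at h2
  change _ = ∫ x, f (A *ᵥ x) at h2
  rw [← h2, mul_inv_cancel_left₀ (abs_ne_zero.2 hA)]

theorem mulVec_dotProduct_inv_mul_transpose {A : Matrix ι ι ℝ} (hA : A.det ≠ 0) (x : ι → ℝ) :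
    (A *ᵥ x) ⬝ᵥ (A * Aᵀ)⁻¹ *ᵥ (A *ᵥ x) = x ⬝ᵥ x := by
  have hAt : Aᵀ.det ≠ 0 := by rwa [det_transpose]
  rw [Matrix.mul_inv_rev, mulVec_mulVec, Matrix.mul_assoc, nonsing_inv_mul _ hA.isUnit, Matrix.mul_one,
    ← vecMul_transpose, ← dotProduct_mulVec, mulVec_mulVec, mul_nonsing_inv _ hAt.isUnit,
    one_mulVec]

theorem integrable_mul_mul_one_add_quadratic_rpow {S : Matrix ι ι ℝ} (hS : S.PosDef) {ν β : ℝ}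
    (hν : 0 < ν) (hβ : 0 < β - (Fintype.card ι : ℝ) / 2 - 1) (a b : ι) :
    Integrable fun y : ι → ℝ => y a * y b * (1 + y ⬝ᵥ S⁻¹ *ᵥ y / ν) ^ (-β) := by
  obtain ⟨A, rfl, hA⟩ := hS.exists_eq_mul_transpose
  rw [← integrable_comp_mulVec_iff hA]
  simp only [mulVec_dotProduct_inv_mul_transpose hA, mulVec_mul_mulVec_mul]
  exact integrable_finsetSum _ fun i _ => integrable_finsetSum _ fun j _ =>
    (integrable_mul_mul_one_add_rpow hν hβ i j).const_mul _

theorem integral_mul_mul_one_add_quadratic_rpow {S : Matrix ι ι ℝ} (hS : S.PosDef) {ν β : ℝ}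
    (hν : 0 < ν) (hβ : 0 < β - (Fintype.card ι : ℝ) / 2 - 1) (a b : ι) :
    ∫ y : ι → ℝ, y a * y b * (1 + y ⬝ᵥ S⁻¹ *ᵥ y / ν) ^ (-β) =
      √S.det * (mixtureMoment ι ν β / Real.Gamma β) * S a b := by
  obtain ⟨A, rfl, hA⟩ := hS.exists_eq_mul_transpose
  have hI (i j : ι) := (integrable_mul_mul_one_add_rpow hν hβ i j).const_mul (A a i * A b j)
  rw [integral_eq_abs_det_mul_integral_comp_mulVec hA]
  simp only [mulVec_dotProduct_inv_mul_transpose hA, mulVec_mul_mulVec_mul]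
  rw [integral_finsetSum _ fun i _ => integrable_finsetSum _ fun j _ => hI i j]
  simp only [integral_finsetSum _ fun j _ => hI _ j, integral_const_mul,
    integral_mul_mul_one_add_rpow hν hβ, mul_ite, mul_zero, Finset.sum_ite_eq, Finset.mem_univ,
    if_true, ← Finset.sum_mul]
  rw [det_mul, det_transpose, Real.sqrt_mul_self_eq_abs, mul_apply]
  simp only [transpose_apply]
  ring

end LinearChange

/-- The weighted second-moment integrand is a constant multiple of a power of the quadratic form. -/
theorem tWeight_pow_mul_centeredTDensity {p : ℕ} {ν : ℝ} (hν : 0 < ν)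
    {S : Matrix (Fin p) (Fin p) ℝ} (hS : S.PosDef) (k : ℕ) (a b : Fin p) (y : Fin p → ℝ) :
    tWeight p ν S y ^ k * (y a * y b) * centeredTDensity p ν S y =
      ((ν + p) / ν) ^ k * (Real.Gamma ((ν + p) / 2) /
        ((π * ν) ^ ((p : ℝ) / 2) * Real.Gamma (ν / 2) * √S.det)) *
      (y a * y b * (1 + y ⬝ᵥ S⁻¹ *ᵥ y / ν) ^ (-((ν + p) / 2 + k))) := by
  have hq : 0 ≤ y ⬝ᵥ S⁻¹ *ᵥ y := by
    simpa using hS.inv.posSemidef.dotProduct_mulVec_nonneg y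
  have hr : 0 < 1 + y ⬝ᵥ S⁻¹ *ᵥ y / ν := by positivity
  have hw : tWeight p ν S y = (ν + p) / ν / (1 + y ⬝ᵥ S⁻¹ *ᵥ y / ν) := by
    have : 0 < ν + y ⬝ᵥ S⁻¹ *ᵥ y := by positivity
    unfold tWeight
    field_simp
  rw [hw, centeredTDensity, div_pow, neg_div,
    neg_add ((ν + p) / 2) (k : ℝ), Real.rpow_add hr, Real.rpow_neg hr.le (k : ℝ), Real.rpow_natCast]
  ring

theorem integrable_tWeight_pow_mul {p : ℕ} {ν : ℝ} (hν : 0 < ν)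
    {S : Matrix (Fin p) (Fin p) ℝ} (hS : S.PosDef) {k : ℕ} (hk : 1 ≤ k) (a b : Fin p) :
    Integrable fun y : Fin p → ℝ =>
      tWeight p ν S y ^ k * (y a * y b) * centeredTDensity p ν S y := by
  have hk' : (1 : ℝ) ≤ k := by exact_mod_cast hk
  simp only [tWeight_pow_mul_centeredTDensity hν hS]
  refine (integrable_mul_mul_one_add_quadratic_rpow hS hν ?_ a b).const_mul _
  rw [Fintype.card_fin]
  linarith

theorem integral_tWeight_pow_mul {p : ℕ} {ν : ℝ} (hν : 0 < ν)
    {S : Matrix (Fin p) (Fin p) ℝ} (hS : S.PosDef) {k : ℕ} (hk : 1 ≤ k) (a b : Fin p) :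
    ∫ y : Fin p → ℝ, tWeight p ν S y ^ k * (y a * y b) * centeredTDensity p ν S y =
      ((ν + p) / ν) ^ k * (ν / 2) * (Real.Gamma ((ν + p) / 2) / Real.Gamma ((ν + p) / 2 + k)) *
        (Real.Gamma (ν / 2 + k - 1) / Real.Gamma (ν / 2)) * S a b := by
  have hk' : (1 : ℝ) ≤ k := by exact_mod_cast hk
  simp only [tWeight_pow_mul_centeredTDensity hν hS]
  rw [integral_const_mul, integral_mul_mul_one_add_quadratic_rpow hS hν
    (by rw [Fintype.card_fin]; linarith), mixtureMoment, Fintype.card_fin,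
    show (ν + p) / 2 + k - (p : ℝ) / 2 - 1 = ν / 2 + k - 1 by ring]
  have hdet : √S.det ≠ 0 := (Real.sqrt_pos.2 hS.det_pos).ne'
  have hpow : (π * ν) ^ ((p : ℝ) / 2) ≠ 0 := by positivity
  generalize (π * ν) ^ ((p : ℝ) / 2) = P at hpow ⊢
  generalize Real.Gamma (ν / 2 + k - 1) = G
  field_simp

/-- weighted second-moment identities for the multivariate t:
`∫ w(y) y yᵀ f(y) dy = Σ` and `∫ w(y)² y yᵀ f(y) dy = ((ν+p)/(ν+p+2)) Σ`, entrywise. -/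
theorem stmt13 (p : ℕ) (hp : 1 ≤ p) (ν : ℝ) (hν : 0 < ν)
    (S : Matrix (Fin p) (Fin p) ℝ) (hS : S.PosDef) :
    ∀ a b : Fin p,
      Integrable (fun y : Fin p → ℝ =>
        tWeight p ν S y * (y a * y b) * centeredTDensity p ν S y) volume ∧
      Integrable (fun y : Fin p → ℝ =>
        (tWeight p ν S y) ^ 2 * (y a * y b) * centeredTDensity p ν S y) volume ∧
      (∫ y : Fin p → ℝ, tWeight p ν S y * (y a * y b) * centeredTDensity p ν S y) =
        S a b ∧
      (∫ y : Fin p → ℝ, (tWeight p ν S y) ^ 2 * (y a * y b) * centeredTDensity p ν S y) =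
        (ν + p) / (ν + p + 2) * S a b := by
  intro a b
  have hν2 : ν / 2 ≠ 0 := by positivity
  have hα : (ν + p) / 2 ≠ 0 := by positivity
  have hα1 : (ν + p) / 2 + 1 ≠ 0 := by positivity
  have hG : Real.Gamma (ν / 2) ≠ 0 := (Real.Gamma_pos_of_pos (by positivity)).ne'
  have hGα : Real.Gamma ((ν + p) / 2) ≠ 0 := (Real.Gamma_pos_of_pos (by positivity)).ne'
  have hint := integrable_tWeight_pow_mul hν hS le_rfl a b
  have h1 := integral_tWeight_pow_mul hν hS le_rfl a b
  have h2 := integral_tWeight_pow_mul hν hS one_le_two a b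
  simp only [pow_one] at hint h1
  refine ⟨hint, integrable_tWeight_pow_mul hν hS one_le_two a b, ?_, ?_⟩
  · rw [h1, Nat.cast_one, add_sub_cancel_right, Real.Gamma_add_one hα]
    field_simp
  · rw [h2, Nat.cast_two, show (ν + p) / 2 + 2 = (ν + p) / 2 + 1 + 1 by ring,
      Real.Gamma_add_one hα1, Real.Gamma_add_one hα, show ν / 2 + 2 - 1 = ν / 2 + 1 by ring,
      Real.Gamma_add_one hν2]
    field_simp
end
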